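/- Let A, B be bounded right ℍ-linear operators on V with AB = BA. Then the surjectivity S-spectrum of their sum is contained in the sum of their surjectivity S-spectra: σ_su(A+B) ⊆ σ_su(A) + σ_su(B). -/

import Mathlib

open MulOpposite Filter Pointwise

noncomputable section

variable {V : Type*} [NormedAddCommGroup V] [NormedSpace ℝ V] [CompleteSpace V]
  [Module (Quaternion ℝ)ᵐᵒᵖ V] [IsScalarTower ℝ (Quaternion ℝ)ᵐᵒᵖ V]
  [SMulCommClass ℝ (Quaternion ℝ)ᵐᵒᵖ V]

/-- `A` is a (bounded) right `ℍ`-linear operator: a bounded real-linear operator on `V`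
commuting with the right scalar multiplication by quaternions. -/
def RightLinear (A : V →L[ℝ] V) : Prop :=
  ∀ (q : Quaternion ℝ) (v : V), A (op q • v) = op q • A v

/-- The pseudo-resolvent operator `R_q(A) = A² - 2(Re q)A + |q|² I`. -/
def pseudoRes (q : Quaternion ℝ) (A : V →L[ℝ] V) : V →L[ℝ] V :=
  A.comp A - (2 * q.re) • A + ‖q‖ ^ 2 • ContinuousLinearMap.id ℝ V

/-- The approximate point S-spectrum of `A`. -/
def sigmaAp (A : V →L[ℝ] V) : Set (Quaternion ℝ) :=
  {q | ∃ φ : ℕ → V, (∀ n, ‖φ n‖ = 1) ∧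
    Tendsto (fun n => ‖pseudoRes q A (φ n)‖) atTop (nhds 0)}

/-- The surjectivity S-spectrum of `A`. -/
def sigmaSu (A : V →L[ℝ] V) : Set (Quaternion ℝ) :=
  {q | ¬ Function.Surjective (pseudoRes q A)}

/-- The S-spectrum of `A`. -/
def sigmaS (A : V →L[ℝ] V) : Set (Quaternion ℝ) :=
  {q | ¬ Function.Bijective (pseudoRes q A)}

theorem aux_surj_of_approx {W : Type*} [NormedAddCommGroup W] [NormedSpace ℂ W] [CompleteSpace W]
    (S : W →L[ℂ] W) (C : ℝ) (hC : ∀ y : W, ‖y‖ ≤ 1 → ∃ x : W, ‖x‖ ≤ C ∧ ‖S x - y‖ ≤ 1 / 2) :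
    Function.Surjective S := by
  have key : ∀ y : W, ∃ x : W, ‖S x - y‖ ≤ 1 / 2 * ‖y‖ ∧ ‖x‖ ≤ C * ‖y‖ := by
    intro y
    by_cases hy : y = 0
    · exact ⟨0, by simp [hy], by simp [hy]⟩
    have hn : 0 < ‖y‖ := norm_pos_iff.mpr hy
    have hc : ((‖y‖ : ℝ) : ℂ) ≠ 0 := by exact_mod_cast hn.ne'
    obtain ⟨x, hx1, hx2⟩ := hC (((‖y‖ : ℝ) : ℂ)⁻¹ • y) (by
      rw [norm_smul, norm_inv, Complex.norm_real, norm_norm, inv_mul_cancel₀ hn.ne'])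
    refine ⟨((‖y‖ : ℝ) : ℂ) • x, ?_, ?_⟩
    · have : S (((‖y‖ : ℝ) : ℂ) • x) - y
          = ((‖y‖ : ℝ) : ℂ) • (S x - ((‖y‖ : ℝ) : ℂ)⁻¹ • y) := by
        rw [smul_sub, smul_smul, mul_inv_cancel₀ hc, one_smul, map_smul]
      rw [this, norm_smul, Complex.norm_real, norm_norm]
      nlinarith
    · rw [norm_smul, Complex.norm_real, norm_norm]
      nlinarith
  choose g hg using key
  intro y
  have C0 : 0 ≤ C := by
    obtain ⟨x, hx, -⟩ := hC 0 (by simp)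
    exact (norm_nonneg x).trans hx
  let h : W → W := fun y => y - S (g y)
  have hle : ∀ y, ‖h y‖ ≤ 1 / 2 * ‖y‖ := by
    intro y
    rw [norm_sub_rev]
    exact (hg y).1
  have hnle : ∀ n : ℕ, ‖h^[n] y‖ ≤ (1 / 2) ^ n * ‖y‖ := by
    intro n
    induction n with
    | zero => simp
    | succ n IH =>
      rw [Function.iterate_succ']
      apply le_trans (hle _) _
      rw [pow_succ', mul_assoc]
      gcongr
  let u : ℕ → W := fun n => g (h^[n] y)
  have ule : ∀ n, ‖u n‖ ≤ (1 / 2) ^ n * (C * ‖y‖) := fun n ↦ by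
    apply le_trans (hg _).2
    calc
      C * ‖h^[n] y‖ ≤ C * ((1 / 2) ^ n * ‖y‖) := by gcongr; exact hnle n
      _ = (1 / 2) ^ n * (C * ‖y‖) := by ring
  have sNu : Summable fun n => ‖u n‖ := by
    refine .of_nonneg_of_le (fun n => norm_nonneg _) ule ?_
    exact Summable.mul_right _ (summable_geometric_of_lt_one (by simp) (by norm_num))
  have su : Summable u := sNu.of_norm
  have fsumeq : ∀ n : ℕ, S (∑ i ∈ Finset.range n, u i) = y - h^[n] y := by
    intro n
    induction n with
    | zero => simp
    | succ n IH => rw [Finset.sum_range_succ, S.map_add, IH, Function.iterate_succ_apply', sub_add]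
  have L₁ : Tendsto (fun n => S (∑ i ∈ Finset.range n, u i)) atTop (nhds (S (tsum u))) :=
    (S.continuous.tendsto _).comp su.hasSum.tendsto_sum_nat
  simp only [fsumeq] at L₁
  have L₂ : Tendsto (fun n => y - h^[n] y) atTop (nhds (y - 0)) := by
    refine tendsto_const_nhds.sub ?_
    rw [tendsto_iff_norm_sub_tendsto_zero]
    simp only [sub_zero]
    refine squeeze_zero (fun _ => norm_nonneg _) hnle ?_
    rw [← zero_mul ‖y‖]
    refine (tendsto_pow_atTop_nhds_zero_of_lt_one ?_ ?_).mul tendsto_const_nhds <;> norm_num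
  exact ⟨tsum u, by simpa using tendsto_nhds_unique L₁ L₂⟩

theorem aux_su_nonempty {Q : Type*} [NormedAddCommGroup Q] [NormedSpace ℂ Q] [CompleteSpace Q]
    [Nontrivial Q] (a : Q →L[ℂ] Q) : ∃ μ : ℂ, ¬ Function.Surjective (fun v => a v - μ • v) := by
  have hne := spectrum.nonempty a
  have hnu : spectrum ℂ a ≠ Set.univ := by
    intro h
    have := (spectrum.isCompact (𝕜 := ℂ) a)
    rw [h] at this
    exact noncompact_univ ℂ this
  obtain ⟨μ, hμ⟩ := nonempty_frontier_iff.mpr ⟨hne, hnu⟩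
  have hμs : μ ∈ spectrum ℂ a := (spectrum.isClosed a).frontier_subset hμ
  rw [← frontier_compl] at hμ
  have hcl : μ ∈ closure (spectrum ℂ a)ᶜ := frontier_subset_closure hμ
  refine ⟨μ, fun hs => hμs ?_⟩
  let T : Q →L[ℂ] Q := algebraMap ℂ (Q →L[ℂ] Q) μ - a
  have hT : ∀ v, T v = μ • v - a v := fun v => by simp [T, Algebra.algebraMap_eq_smul_one]
  have hTs : Function.Surjective T := by
    intro y
    obtain ⟨x, hx⟩ := hs (-y)
    refine ⟨x, ?_⟩
    have hx' : a x - μ • x = -y := hx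
    rw [hT, ← neg_sub, hx', neg_neg]
  obtain ⟨C, C0, hC⟩ := T.exists_preimage_norm_le hTs
  obtain ⟨ν, hν, hd⟩ := Metric.mem_closure_iff.mp hcl (1 / (4 * C)) (by positivity)
  have hu : IsUnit (algebraMap ℂ (Q →L[ℂ] Q) ν - a) := by
    simpa [spectrum.mem_iff] using hν
  obtain ⟨R, hR⟩ := hu
  have hRv : ∀ v, (R : Q →L[ℂ] Q) v = ν • v - a v := fun v => by
    rw [hR]; simp [Algebra.algebraMap_eq_smul_one]
  set r : Q →L[ℂ] Q := ((R⁻¹ : (Q →L[ℂ] Q)ˣ) : Q →L[ℂ] Q) with hr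
  have hrR : ∀ v, r ((R : Q →L[ℂ] Q) v) = v := fun v => by
    have := congrArg (fun f : Q →L[ℂ] Q => f v) (R.inv_mul)
    exact this
  have hdn : ‖ν - μ‖ * (4 * C) < 1 := by
    rw [dist_comm, dist_eq_norm] at hd
    rwa [lt_div_iff₀ (by positivity)] at hd
  have hrn : ‖r‖ ≤ C + ‖r‖ * (‖ν - μ‖ * C) := by
    refine r.opNorm_le_bound (by positivity) fun y => ?_
    obtain ⟨x, hx, hxn⟩ := hC y
    have h1 : r y = x - r ((ν - μ) • x) := by
      have : y = (R : Q →L[ℂ] Q) x - (ν - μ) • x := by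
        rw [hRv, ← hx, hT, sub_smul]; abel
      conv_lhs => rw [this, map_sub, hrR]
    rw [h1]
    calc ‖x - r ((ν - μ) • x)‖ ≤ ‖x‖ + ‖r ((ν - μ) • x)‖ := norm_sub_le _ _
      _ ≤ ‖x‖ + ‖r‖ * (‖ν - μ‖ * ‖x‖) := by
        gcongr
        rw [← norm_smul]
        exact r.le_opNorm _
      _ ≤ C * ‖y‖ + ‖r‖ * (‖ν - μ‖ * (C * ‖y‖)) := by gcongr
      _ = _ := by ring
  have hr2 : ‖r‖ ≤ 2 * C := by nlinarith [norm_nonneg r]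
  have hrpos : 0 < ‖r‖ := norm_pos_iff.mpr (Units.ne_zero _)
  have : IsUnit T := by
    refine ⟨R.ofNearby T ?_, rfl⟩
    have h2 : T - (R : Q →L[ℂ] Q) = (μ - ν) • (1 : Q →L[ℂ] Q) := by
      ext v; simp [hT, hRv, sub_smul]
    rw [h2, norm_smul, norm_one, mul_one, norm_sub_rev, ← hr, ← one_div, lt_div_iff₀ hrpos]
    nlinarith [mul_le_mul_of_nonneg_left hr2 (norm_nonneg (ν - μ)), mul_nonneg (norm_nonneg (ν - μ)) C0.le]
  exact this

open scoped ENNReal in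
theorem aux_complex {W : Type*} [NormedAddCommGroup W] [NormedSpace ℂ W] [CompleteSpace W]
    (A B : W →L[ℂ] W) (hc : ∀ v, A (B v) = B (A v)) (l : ℂ)
    (hS : ¬ Function.Surjective (fun v => A v + B v - l • v)) :
    ∃ μ : ℂ, ¬ Function.Surjective (fun v => A v - μ • v) ∧
      ¬ Function.Surjective (fun v => B v - (l - μ) • v) := by
  let ι := {y : W // ‖y‖ ≤ 1}
  let L := lp (fun _ : ι => W) ∞
  let up : (W →L[ℂ] W) → (L →L[ℂ] L) := fun T =>
    lp.mapCLM ∞ (fun _ => T) (norm_nonneg T) (fun _ => le_rfl)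
  have hup : ∀ (T : W →L[ℂ] W) (x : L) (i : ι), (up T x) i = T (x i) := fun T x i => rfl
  let S : W →L[ℂ] W := A + B - l • ContinuousLinearMap.id ℂ W
  have hSv : ∀ v, S v = A v + B v - l • v := fun v => by simp [S]
  have hSs : ¬ Function.Surjective S := by
    intro h; exact hS fun y => (h y).imp fun x hx => by rw [← hx, hSv]
  let N : Submodule ℂ L := (LinearMap.range (up S).toLinearMap).topologicalClosure
  have hNc : IsClosed (N : Set L) := Submodule.isClosed_topologicalClosure _
  -- the identity family is not in `N`
  let e : L := ⟨fun i => i.1, memℓp_infty ⟨1, by rintro _ ⟨i, rfl⟩; exact i.2⟩⟩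
  have he : e ∉ N := by
    intro h
    have h' : e ∈ closure ((LinearMap.range (up S).toLinearMap : Submodule ℂ L) : Set L) := h
    obtain ⟨_, ⟨x, rfl⟩, hx⟩ := Metric.mem_closure_iff.mp h' (1 / 2) (by norm_num)
    refine hSs (aux_surj_of_approx S ‖x‖ fun y hy => ⟨x ⟨y, hy⟩, ?_, ?_⟩)
    · exact lp.norm_apply_le_norm ENNReal.top_ne_zero x _
    · rw [dist_comm, dist_eq_norm] at hx
      exact (lp.norm_apply_le_norm ENNReal.top_ne_zero (up S x - e) ⟨y, hy⟩).trans hx.le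
  have hinv : ∀ x ∈ N, up A x ∈ N := by
    intro x hx
    have : Set.MapsTo (up A) ((LinearMap.range (up S).toLinearMap : Submodule ℂ L) : Set L)
        ((LinearMap.range (up S).toLinearMap : Submodule ℂ L) : Set L) := by
      rintro _ ⟨x, rfl⟩
      refine ⟨up A x, ?_⟩
      ext i
      change S (A (x i)) = A (S (x i))
      simp [hSv, hc]
    exact this.closure (up A).continuous hx
  let a : (L ⧸ N) →L[ℂ] (L ⧸ N) := N.liftQL (N.mkQL.comp (up A)) (by
    intro x hx
    have := hinv x hx
    simpa using this)
  have ha : ∀ x : L, a (N.mkQ x) = N.mkQ (up A x) := fun x => rfl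
  have : Nontrivial (L ⧸ N) := by
    refine ⟨N.mkQ e, 0, fun h => he ?_⟩
    simpa using h
  obtain ⟨μ, hμ⟩ := aux_su_nonempty a
  -- surjectivity lifts to `L`
  have lift : ∀ T : W →L[ℂ] W, Function.Surjective T → Function.Surjective (up T) := by
    intro T hT y
    obtain ⟨C, C0, hC⟩ := T.exists_preimage_norm_le hT
    choose g hg hgn using hC
    refine ⟨⟨fun i => g (y i), memℓp_infty ⟨C * ‖y‖, ?_⟩⟩, ?_⟩
    · rintro _ ⟨i, rfl⟩
      refine (hgn _).trans ?_
      gcongr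
      exact lp.norm_apply_le_norm ENNReal.top_ne_zero y _
    · ext i
      exact hg _
  refine ⟨μ, fun h => hμ ?_, fun h => hμ ?_⟩
  · intro y
    obtain ⟨y, rfl⟩ := N.mkQ_surjective y
    let T : W →L[ℂ] W := A - μ • ContinuousLinearMap.id ℂ W
    obtain ⟨x, rfl⟩ := lift T (fun y => (h y).imp fun x hx => by simpa [T] using hx) y
    refine ⟨N.mkQ x, ?_⟩
    change a (N.mkQ x) - μ • N.mkQ x = _
    rw [ha, ← map_smul, ← map_sub]
    congr 1
  · intro y
    obtain ⟨y, rfl⟩ := N.mkQ_surjective y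
    let T : W →L[ℂ] W := B - (l - μ) • ContinuousLinearMap.id ℂ W
    obtain ⟨x, rfl⟩ := lift T (fun y => (h y).imp fun x hx => by simpa [T] using hx) y
    refine ⟨N.mkQ (-x), ?_⟩
    change a (N.mkQ (-x)) - μ • N.mkQ (-x) = _
    rw [ha, ← map_smul, ← map_sub, ← sub_eq_zero, ← map_sub, Submodule.mkQ_apply,
      Submodule.Quotient.mk_eq_zero]
    have : up A (-x) - μ • (-x) - up T x = up S (-x) := by
      ext i
      change A (-(x i)) - μ • (-(x i)) - T (x i) = S (-(x i))
      simp [hSv, T, sub_smul]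
      abel
    rw [this]
    exact Submodule.le_topologicalClosure _ ⟨-x, rfl⟩

/-- The quadratic operator over the complex numbers. -/
def auxP {W : Type*} [AddCommGroup W] [Module ℂ W] (z : ℂ) (A : W → W) (v : W) : W :=
  A (A v) - ((2 * z.re : ℝ) : ℂ) • A v + ((‖z‖ ^ 2 : ℝ) : ℂ) • v

theorem auxP_eq {W : Type*} [NormedAddCommGroup W] [NormedSpace ℂ W] (z : ℂ) (A : W →L[ℂ] W)
    (v : W) : auxP z A v = (fun v => A v - z • v) ((fun v => A v - (starRingEnd ℂ z) • v) v) := by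
  have h1 : ((2 * z.re : ℝ) : ℂ) = z + starRingEnd ℂ z := by
    rw [Complex.add_conj]
  have h2 : ((‖z‖ ^ 2 : ℝ) : ℂ) = z * starRingEnd ℂ z := by
    rw [Complex.mul_conj, Complex.normSq_eq_norm_sq]
  simp only [auxP, h1, h2, map_sub, map_smul, smul_sub, add_smul, mul_smul]
  abel

theorem auxP_conj {W : Type*} [AddCommGroup W] [Module ℂ W] (z : ℂ) (A : W → W) :
    auxP (starRingEnd ℂ z) A = auxP z A := by
  funext v; simp [auxP]

theorem auxP_surj {W : Type*} [NormedAddCommGroup W] [NormedSpace ℂ W] (z : ℂ) (A : W →L[ℂ] W)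
    (h : Function.Surjective (auxP z A)) : Function.Surjective (fun v => A v - z • v) := by
  intro y
  obtain ⟨x, hx⟩ := h y
  rw [auxP_eq] at hx
  exact ⟨_, hx⟩

theorem aux_complex2 {W : Type*} [NormedAddCommGroup W] [NormedSpace ℂ W] [CompleteSpace W]
    (A B : W →L[ℂ] W) (hc : ∀ v, A (B v) = B (A v)) (l : ℂ)
    (hS : ¬ Function.Surjective (auxP l (fun v => A v + B v))) :
    ∃ μ ν : ℂ, μ + ν = l ∧ ¬ Function.Surjective (auxP μ A) ∧
      ¬ Function.Surjective (auxP ν B) := by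
  by_cases h1 : Function.Surjective (fun v => A v + B v - l • v)
  · by_cases h2 : Function.Surjective (fun v => A v + B v - (starRingEnd ℂ l) • v)
    · refine absurd ?_ hS
      have : auxP l (fun v => A v + B v)
        = (fun v => A v + B v - l • v) ∘ (fun v => A v + B v - (starRingEnd ℂ l) • v) := by
        funext v
        exact auxP_eq l (A + B) v
      rw [this]
      exact h1.comp h2
    · obtain ⟨μ, h3, h4⟩ := aux_complex A B hc _ h2
      refine ⟨starRingEnd ℂ μ, l - starRingEnd ℂ μ, by ring, ?_, ?_⟩
      · rw [auxP_conj]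
        exact fun h => h3 (auxP_surj _ _ h)
      · have : l - starRingEnd ℂ μ = starRingEnd ℂ (starRingEnd ℂ l - μ) := by simp
        rw [this, auxP_conj]
        exact fun h => h4 (auxP_surj _ _ h)
  · obtain ⟨μ, h3, h4⟩ := aux_complex A B hc _ h1
    exact ⟨μ, l - μ, by ring, fun h => h3 (auxP_surj _ _ h), fun h => h4 (auxP_surj _ _ h)⟩

theorem aux_unit (q : Quaternion ℝ) : ∃ (u : Quaternion ℝ) (y : ℝ), u.re = 0 ∧
    u.imI ^ 2 + u.imJ ^ 2 + u.imK ^ 2 = 1 ∧ q = (q.re : Quaternion ℝ) + y • u := by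
  by_cases h : q.im = 0
  · obtain ⟨u, hu0, hu1⟩ : ∃ u : Quaternion ℝ, u.re = 0 ∧
        u.imI ^ 2 + u.imJ ^ 2 + u.imK ^ 2 = 1 := ⟨⟨0, 1, 0, 0⟩, rfl, by norm_num⟩
    refine ⟨u, 0, hu0, hu1, ?_⟩
    have := Quaternion.re_add_im q
    rw [h] at this
    rw [zero_smul]
    exact this.symm
  · have hn : ‖q.im‖ ≠ 0 := norm_ne_zero_iff.mpr h
    have hsq : ‖q.im‖ ^ 2 = q.imI ^ 2 + q.imJ ^ 2 + q.imK ^ 2 := by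
      rw [sq, ← Quaternion.normSq_eq_norm_mul_self, Quaternion.normSq_def']
      simp
    refine ⟨‖q.im‖⁻¹ • q.im, ‖q.im‖, by simp, ?_, ?_⟩
    · simp only [Quaternion.imI_smul, Quaternion.imJ_smul, Quaternion.imK_smul,
        Quaternion.imI_im, Quaternion.imJ_im, Quaternion.imK_im, smul_eq_mul, mul_pow]
      rw [← mul_add, ← mul_add, ← hsq]
      field_simp
    · rw [smul_smul, mul_inv_cancel₀ hn, one_smul, Quaternion.re_add_im]

theorem sigmaSu_add_subset (hnorm : ∀ (q : Quaternion ℝ) (v : V), ‖op q • v‖ = ‖v‖ * ‖q‖)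
    (A B : V →L[ℝ] V) (hA : RightLinear A) (hB : RightLinear B)
    (hcomm : A.comp B = B.comp A) :
    sigmaSu (A + B) ⊆ sigmaSu A + sigmaSu B := by
  intro q hq
  obtain ⟨u, y, hu0, hu1, hqu⟩ := aux_unit q
  let ρ : ℂ → Quaternion ℝ := fun z => (z.re : Quaternion ℝ) + z.im • u
  have huu : u * u = -1 := by
    apply Quaternion.ext
    · rw [Quaternion.re_mul, Quaternion.re_neg, Quaternion.re_one, hu0]
      linear_combination -hu1
    · rw [Quaternion.imI_mul, Quaternion.imI_neg, Quaternion.imI_one, hu0]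
      ring
    · rw [Quaternion.imJ_mul, Quaternion.imJ_neg, Quaternion.imJ_one, hu0]
      ring
    · rw [Quaternion.imK_mul, Quaternion.imK_neg, Quaternion.imK_one, hu0]
      ring
  have hρre : ∀ z, (ρ z).re = z.re := fun z => by simp [ρ, hu0]
  have hρn : ∀ z, ‖ρ z‖ = ‖z‖ := fun z => by
    have h1 : ‖ρ z‖ ^ 2 = ‖z‖ ^ 2 := by
      rw [sq, ← Quaternion.normSq_eq_norm_mul_self, Quaternion.normSq_def',
        ← Complex.normSq_eq_norm_sq, Complex.normSq_apply]
      simp [ρ, hu0]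
      linear_combination z.im ^ 2 * hu1
    exact (sq_eq_sq₀ (norm_nonneg _) (norm_nonneg _)).mp h1
  have hρadd : ∀ z w, ρ (z + w) = ρ z + ρ w := fun z w => by
    simp only [ρ, Complex.add_re, Complex.add_im, Quaternion.coe_add, add_smul]; abel
  let f : ℂ →ₐ[ℝ] (Quaternion ℝ)ᵐᵒᵖ := Complex.lift ⟨op u, by rw [← op_mul, huu]; rfl⟩
  have hf : ∀ z, f z = op (ρ z) := fun z => by
    simp only [f, Complex.lift_apply, Complex.liftAux_apply, ρ, op_add, op_smul]
    rfl
  have hfr : ∀ (r : ℝ) (v : V), f (r : ℂ) • v = r • v := fun r v => by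
    have : f (r : ℂ) = r • (1 : (Quaternion ℝ)ᵐᵒᵖ) := by
      rw [← Algebra.algebraMap_eq_smul_one]
      exact f.commutes r
    rw [this, smul_assoc, one_smul]
  let m : Module ℂ V := Module.compHom V f.toRingHom
  have hm : ∀ (z : ℂ) (v : V), z • v = f z • v := fun _ _ => rfl
  let ns : NormedSpace ℂ V :=
    { m with
      norm_smul_le := fun z v => by
        rw [hm, hf, hnorm, hρn, mul_comm] }
  have hm' : ∀ (z : ℂ) (v : V), z • v = f z • v := fun _ _ => rfl
  let A' : V →L[ℂ] V :=
    { toFun := A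
      map_add' := A.map_add
      map_smul' := fun z v => by
        rw [hm', hf, hA]; simp only [RingHom.id_apply]; rw [hm', hf]
      cont := A.continuous }
  let B' : V →L[ℂ] V :=
    { toFun := B
      map_add' := B.map_add
      map_smul' := fun z v => by
        rw [hm', hf, hB]; simp only [RingHom.id_apply]; rw [hm', hf]
      cont := B.continuous }
  have hP : ∀ (z : ℂ) (T : V →L[ℝ] V), auxP z T = pseudoRes (ρ z) T := fun z T => by
    funext v
    simp only [auxP, pseudoRes, hm', hfr, hρre, hρn]
    rfl
  have hc : ∀ v, A' (B' v) = B' (A' v) := fun v =>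
    congrArg (fun T : V →L[ℝ] V => T v) hcomm
  have hql : q = ρ ⟨q.re, y⟩ := hqu
  have hq' : ¬ Function.Surjective (auxP (⟨q.re, y⟩ : ℂ) (fun v => A' v + B' v)) := by
    have := hP ⟨q.re, y⟩ (A + B)
    change ¬ Function.Surjective (auxP (⟨q.re, y⟩ : ℂ) (A + B : V →L[ℝ] V))
    rw [this, ← hql]
    exact hq
  obtain ⟨μ, ν, h1, h2, h3⟩ := aux_complex2 A' B' hc _ hq'
  refine Set.mem_add.mpr ⟨ρ μ, ?_, ρ ν, ?_, ?_⟩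
  · change ¬ Function.Surjective (pseudoRes (ρ μ) A)
    rw [← hP]; exact h2
  · change ¬ Function.Surjective (pseudoRes (ρ ν) B)
    rw [← hP]; exact h3
  · rw [← hρadd, h1, ← hql]
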